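/- An Egorov space has cyclic parallel Ricci tensor ((∇_X Ric)(X,X) = 0 for all vector fields X) if and only if it is locally symmetric, i.e., if and only if (f')² - 2ff'' = 4Cf² for some constant C. -/

import Mathlib

noncomputable section

/-- Partial derivative of a function on `ℝⁿ` in the `a`-th coordinate direction. -/
def pd {N : ℕ} (a : Fin N) (h : (Fin N → ℝ) → ℝ) (x : Fin N → ℝ) : ℝ :=
  deriv (fun t => h (Function.update x a t)) (x a)

/-- The index of the coordinate `x_n` (dimension `n = m+3`). -/
def lastIdx (m : ℕ) : Fin (m + 3) := ⟨m + 2, by omega⟩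

/-- The index of the coordinate `x_{n-1}`. -/
def penIdx (m : ℕ) : Fin (m + 3) := ⟨m + 1, by omega⟩

/-- The Egorov metric `g_f = f(x_n) Σ_{i=1}^{n-2} (dx_i)² + 2 dx_{n-1} dx_n` on `ℝⁿ`, `n = m+3`. -/
def gE (m : ℕ) (f : ℝ → ℝ) (x : Fin (m + 3) → ℝ) (i j : Fin (m + 3)) : ℝ :=
  if i = j ∧ (i : ℕ) < m + 1 then f (x (lastIdx m))
  else if (i = penIdx m ∧ j = lastIdx m) ∨ (i = lastIdx m ∧ j = penIdx m) then 1
  else 0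

/-- Christoffel symbols `Γ^k_{ij}` of the Egorov metric:
`∇_{∂_i}∂_i = -(f'/2)∂_{n-1}`, `∇_{∂_i}∂_n = (f'/(2f))∂_i` for spatial `i`, all others zero. -/
def ΓE (m : ℕ) (f : ℝ → ℝ) (x : Fin (m + 3) → ℝ) (k i j : Fin (m + 3)) : ℝ :=
  if (i : ℕ) < m + 1 ∧ j = i ∧ k = penIdx m then -(deriv f (x (lastIdx m)) / 2)
  else if (i : ℕ) < m + 1 ∧ j = lastIdx m ∧ k = i then
    deriv f (x (lastIdx m)) / (2 * f (x (lastIdx m)))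
  else if (j : ℕ) < m + 1 ∧ i = lastIdx m ∧ k = j then
    deriv f (x (lastIdx m)) / (2 * f (x (lastIdx m)))
  else 0

/-- Component on `∂_l` of `R(∂_i,∂_j)∂_k`, with the sign convention
`R(X,Y) = ∇_{[X,Y]} - [∇_X, ∇_Y]` (in coordinates `[∂_i,∂_j] = 0`). -/
def RopE (m : ℕ) (f : ℝ → ℝ) (x : Fin (m + 3) → ℝ) (i j k l : Fin (m + 3)) : ℝ :=
  -(pd i (fun y => ΓE m f y l j k) x - pd j (fun y => ΓE m f y l i k) x
    + ∑ s, (ΓE m f x l i s * ΓE m f x s j k - ΓE m f x l j s * ΓE m f x s i k))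

/-- The (0,4)-curvature tensor `R(∂_i,∂_j,∂_k,∂_h) = ⟨R(∂_i,∂_j)∂_k, ∂_h⟩`. -/
def R4E (m : ℕ) (f : ℝ → ℝ) (x : Fin (m + 3) → ℝ) (i j k h : Fin (m + 3)) : ℝ :=
  ∑ l, RopE m f x i j k l * gE m f x l h

/-- Ricci tensor `Ric(X,Y) = trace (Z ↦ R(X,Z)Y)`. -/
def RicE (m : ℕ) (f : ℝ → ℝ) (x : Fin (m + 3) → ℝ) (i j : Fin (m + 3)) : ℝ :=
  ∑ k, RopE m f x i k j k

/-- Covariant derivative `(∇_{∂_a} R)(∂_i,∂_j,∂_k,∂_h)` of the (0,4)-curvature tensor. -/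
def covR4E (m : ℕ) (f : ℝ → ℝ) (x : Fin (m + 3) → ℝ) (a i j k h : Fin (m + 3)) : ℝ :=
  pd a (fun y => R4E m f y i j k h) x
    - ∑ s, (ΓE m f x s a i * R4E m f x s j k h + ΓE m f x s a j * R4E m f x i s k h
      + ΓE m f x s a k * R4E m f x i j s h + ΓE m f x s a h * R4E m f x i j k s)

/-- Covariant derivative `(∇_{∂_a} Ric)(∂_i,∂_j)` of the Ricci tensor. -/
def covRicE (m : ℕ) (f : ℝ → ℝ) (x : Fin (m + 3) → ℝ) (a i j : Fin (m + 3)) : ℝ :=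
  pd a (fun y => RicE m f y i j) x
    - ∑ s, (ΓE m f x s a i * RicE m f x s j + ΓE m f x s a j * RicE m f x i s)

/-- Covariant derivative of the curvature operator, `(∇_{∂_a} R)(∂_i,∂_j)∂_k` component `l`. -/
def covRopE (m : ℕ) (f : ℝ → ℝ) (x : Fin (m + 3) → ℝ) (a i j k l : Fin (m + 3)) : ℝ :=
  pd a (fun y => RopE m f y i j k l) x
    + ∑ s, (ΓE m f x l a s * RopE m f x i j k s - ΓE m f x s a i * RopE m f x s j k l
      - ΓE m f x s a j * RopE m f x i s k l - ΓE m f x s a k * RopE m f x i j s l)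

/-- The matrix of the curvature operator `R(u,v)` in the coordinate frame. -/
def RMatE (m : ℕ) (f : ℝ → ℝ) (x : Fin (m + 3) → ℝ) (u v : Fin (m + 3) → ℝ) :
    Matrix (Fin (m + 3)) (Fin (m + 3)) ℝ :=
  Matrix.of fun l k => ∑ i, ∑ j, u i * v j * RopE m f x i j k l

/-- The matrix of the Jacobi operator `J_u = R(u,·)u` in the coordinate frame. -/
def JMatE (m : ℕ) (f : ℝ → ℝ) (x : Fin (m + 3) → ℝ) (u : Fin (m + 3) → ℝ) :
    Matrix (Fin (m + 3)) (Fin (m + 3)) ℝ :=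
  Matrix.of fun l k => ∑ i, ∑ j, u i * u j * RopE m f x i k j l

/-- The matrix of the Szabó operator `S_u = (∇_u R)(u,·)u` in the coordinate frame. -/
def SMatE (m : ℕ) (f : ℝ → ℝ) (x : Fin (m + 3) → ℝ) (u : Fin (m + 3) → ℝ) :
    Matrix (Fin (m + 3)) (Fin (m + 3)) ℝ :=
  Matrix.of fun l k => ∑ a, ∑ i, ∑ j, u a * u i * u j * covRopE m f x a i k j l

/-- The inner product of tangent vectors with respect to the Egorov metric. -/
def gdotE (m : ℕ) (f : ℝ → ℝ) (x : Fin (m + 3) → ℝ) (u v : Fin (m + 3) → ℝ) : ℝ :=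
  ∑ i, ∑ j, gE m f x i j * u i * v j

/-- The scalar function `((f')² - 2 f f'')/(4 f²)`. -/
def cE (f : ℝ → ℝ) (t : ℝ) : ℝ :=
  ((deriv f t) ^ 2 - 2 * f t * deriv (deriv f) t) / (4 * (f t) ^ 2)

/-- The matrix of the Ricci operator: only nonzero entry at position `(n-1, n)`. -/
def QMatE (m : ℕ) (f : ℝ → ℝ) (x : Fin (m + 3) → ℝ) :
    Matrix (Fin (m + 3)) (Fin (m + 3)) ℝ :=
  Matrix.of fun i j =>
    if i = penIdx m ∧ j = lastIdx m then ((m : ℝ) + 1) * cE f (x (lastIdx m)) else 0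

def ee (m : ℕ) (i : Fin (m + 3)) : ℝ := if i = lastIdx m then 1 else 0
def pp (m : ℕ) (i : Fin (m + 3)) : ℝ := if i = penIdx m then 1 else 0
def ss (m : ℕ) (i : Fin (m + 3)) : ℝ := if (i : ℕ) < m + 1 then 1 else 0
def dd {m : ℕ} (i j : Fin (m + 3)) : ℝ := if i = j then 1 else 0
def GG {m : ℕ} (i j : Fin (m + 3)) : ℝ := if i = j ∧ (i : ℕ) < m + 1 then 1 else 0

lemma trich {m : ℕ} (i : Fin (m + 3)) : i = lastIdx m ∨ i = penIdx m ∨ (i : ℕ) < m + 1 := by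
  have := i.2
  simp only [Fin.ext_iff, lastIdx, penIdx]
  omega

lemma ee_L (m : ℕ) : ee m (lastIdx m) = 1 := by simp [ee]
lemma ee_P (m : ℕ) : ee m (penIdx m) = 0 := by simp [ee, lastIdx, penIdx]
lemma ee_S {m : ℕ} {i : Fin (m + 3)} (h : (i : ℕ) < m + 1) : ee m i = 0 := by
  simp only [ee, Fin.ext_iff, lastIdx]; rw [if_neg]; omega
lemma pp_L (m : ℕ) : pp m (lastIdx m) = 0 := by simp [pp, lastIdx, penIdx]
lemma pp_P (m : ℕ) : pp m (penIdx m) = 1 := by simp [pp]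
lemma pp_S {m : ℕ} {i : Fin (m + 3)} (h : (i : ℕ) < m + 1) : pp m i = 0 := by
  simp only [pp, Fin.ext_iff, penIdx]; rw [if_neg]; omega
lemma ss_L (m : ℕ) : ss m (lastIdx m) = 0 := by simp [ss, lastIdx]
lemma ss_P (m : ℕ) : ss m (penIdx m) = 0 := by simp [ss, penIdx]
lemma ss_S {m : ℕ} {i : Fin (m + 3)} (h : (i : ℕ) < m + 1) : ss m i = 1 := by simp [ss, h]
lemma GG_comm {m : ℕ} (i j : Fin (m + 3)) : GG i j = GG j i := by
  unfold GG; by_cases h : i = j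
  · subst h; rfl
  · simp [h, Ne.symm h]
lemma GG_L {m : ℕ} (j : Fin (m + 3)) : GG (lastIdx m) j = 0 := by simp [GG, lastIdx]
lemma GG_P {m : ℕ} (j : Fin (m + 3)) : GG (penIdx m) j = 0 := by simp [GG, penIdx]
lemma GG_L' {m : ℕ} (j : Fin (m + 3)) : GG j (lastIdx m) = 0 := by rw [GG_comm, GG_L]
lemma GG_P' {m : ℕ} (j : Fin (m + 3)) : GG j (penIdx m) = 0 := by rw [GG_comm, GG_P]
lemma dd_S {m : ℕ} {i j : Fin (m + 3)} (h : (i : ℕ) < m + 1) : dd i j = GG i j := by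
  simp [dd, GG, h]
lemma dd_S' {m : ℕ} {i j : Fin (m + 3)} (h : (j : ℕ) < m + 1) : dd i j = GG j i := by
  rw [GG_comm]; unfold dd GG; by_cases e : i = j
  · subst e; simp [h]
  · simp [e]

/-- Christoffel symbols as functions of the last coordinate's data. -/
lemma Gam_eq (m : ℕ) (f : ℝ → ℝ) (x : Fin (m + 3) → ℝ) (k i j : Fin (m + 3)) :
    ΓE m f x k i j = GG i j * pp m k * (-(deriv f (x (lastIdx m)) / 2))
      + (ss m i * ee m j * dd k i + ss m j * ee m i * dd k j)
        * (deriv f (x (lastIdx m)) / (2 * f (x (lastIdx m)))) := by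
  unfold ΓE
  rcases trich i with rfl | rfl | hi <;> rcases trich j with rfl | rfl | hj <;>
    simp [*, GG_L, GG_P, GG_L', GG_P', ee_L, ee_P, ee_S, ss_L, ss_P, ss_S]
  all_goals first
    | (have hL : ¬ ((lastIdx m : Fin (m+3)) : ℕ) < m + 1 := by simp [lastIdx]
       have hP : ¬ ((penIdx m : Fin (m+3)) : ℕ) < m + 1 := by simp [penIdx]
       have hLP : lastIdx m ≠ penIdx m := by simp [lastIdx, penIdx]
       have e1 : ∀ i : Fin (m+3), (i : ℕ) < m + 1 → i ≠ lastIdx m := by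
         rintro i h rfl; exact hL h
       have e2 : ∀ i : Fin (m+3), (i : ℕ) < m + 1 → i ≠ penIdx m := by
         rintro i h rfl; exact hP h
       try simp only [GG, pp, dd]
       grind)

lemma contract (m : ℕ) (f : ℝ → ℝ) (x : Fin (m + 3) → ℝ) (T : Fin (m + 3) → ℝ)
    (i j : Fin (m + 3)) :
    ∑ s, ΓE m f x s i j * T s = GG i j * (-(deriv f (x (lastIdx m)) / 2)) * T (penIdx m)
      + (ss m i * ee m j * T i + ss m j * ee m i * T j)
        * (deriv f (x (lastIdx m)) / (2 * f (x (lastIdx m)))) := by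
  have h : ∀ s, ΓE m f x s i j * T s =
      (GG i j * (-(deriv f (x (lastIdx m)) / 2))) * (if s = penIdx m then T s else 0)
      + ss m i * ee m j * (deriv f (x (lastIdx m)) / (2 * f (x (lastIdx m))))
          * (if s = i then T s else 0)
      + ss m j * ee m i * (deriv f (x (lastIdx m)) / (2 * f (x (lastIdx m))))
          * (if s = j then T s else 0) := by
    intro s
    rw [Gam_eq, pp, dd, dd]
    split_ifs <;> ring
  simp_rw [h, Finset.sum_add_distrib, ← Finset.mul_sum]
  simp only [Finset.sum_ite_eq', Finset.mem_univ, if_true]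
  ring

lemma pd_last (m : ℕ) (φ : ℝ → ℝ) (φ' : ℝ) (x : Fin (m + 3) → ℝ) (a : Fin (m + 3))
    (h : HasDerivAt φ φ' (x (lastIdx m))) :
    pd a (fun y => φ (y (lastIdx m))) x = ee m a * φ' := by
  unfold pd ee
  by_cases ha : a = lastIdx m
  · subst ha
    simpa using h.deriv
  · have : ∀ t, Function.update x a t (lastIdx m) = x (lastIdx m) := by
      intro t; rw [Function.update_of_ne (Ne.symm ha)]
    simp [this, ha]

section
variable {m : ℕ} {f : ℝ → ℝ} (hf : ContDiff ℝ (⊤ : ℕ∞) f) (hfpos : ∀ t, 0 < f t)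

lemma hd0 (hf : ContDiff ℝ (⊤ : ℕ∞) f) (t : ℝ) : HasDerivAt f (deriv f t) t :=
  (hf.differentiable (by simp) t).hasDerivAt

lemma smooth1 (hf : ContDiff ℝ (⊤ : ℕ∞) f) : ContDiff ℝ (⊤ : ℕ∞) (deriv f) :=
  (contDiff_infty_iff_deriv.1 hf).2

lemma Gam_pd (hf : ContDiff ℝ (⊤ : ℕ∞) f) (hfpos : ∀ t, 0 < f t) (x : Fin (m + 3) → ℝ)
    (a k i j : Fin (m + 3)) :
    pd a (fun y => ΓE m f y k i j) x = ee m a *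
      (GG i j * pp m k * (-(deriv (deriv f) (x (lastIdx m)) / 2))
      + (ss m i * ee m j * dd k i + ss m j * ee m i * dd k j)
        * ((deriv (deriv f) (x (lastIdx m)) * (2 * f (x (lastIdx m)))
          - deriv f (x (lastIdx m)) * (2 * deriv f (x (lastIdx m))))
            / (2 * f (x (lastIdx m))) ^ 2)) := by
  simp_rw [Gam_eq]
  refine pd_last m (fun t => GG i j * pp m k * (-(deriv f t / 2))
      + (ss m i * ee m j * dd k i + ss m j * ee m i * dd k j)
        * (deriv f t / (2 * f t))) _ x a ?_
  have h0 := hd0 hf (x (lastIdx m))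
  have h1 := hd0 (smooth1 hf) (x (lastIdx m))
  have hne : 2 * f (x (lastIdx m)) ≠ 0 := by have := hfpos (x (lastIdx m)); positivity
  exact ((h1.div_const 2).neg.const_mul _).add ((h1.div (h0.const_mul 2) hne).const_mul _)

lemma Rop_eq (hf : ContDiff ℝ (⊤ : ℕ∞) f) (hfpos : ∀ t, 0 < f t) (x : Fin (m + 3) → ℝ)
    (i j k l : Fin (m + 3)) :
    RopE m f x i j k l = cE f (x (lastIdx m)) *
      (ee m i * ee m k * GG j l - ee m j * ee m k * GG i l
       - f (x (lastIdx m)) * pp m l * (ee m i * GG j k - ee m j * GG i k)) := by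
  have hne : f (x (lastIdx m)) ≠ 0 := (hfpos _).ne'
  unfold RopE cE
  rw [Gam_pd hf hfpos, Gam_pd hf hfpos, Finset.sum_sub_distrib]
  have c1 := contract m f x (fun s => ΓE m f x l i s) j k
  have c2 := contract m f x (fun s => ΓE m f x l j s) i k
  simp_rw [mul_comm (ΓE m f x l _ _)]
  rw [c1, c2]
  simp only [Gam_eq]
  generalize deriv (deriv f) (x (lastIdx m)) = F2
  generalize deriv f (x (lastIdx m)) = F1
  generalize f (x (lastIdx m)) = F at hne
  have e := @GG_comm m
  rcases trich i with rfl | rfl | hi <;> rcases trich j with rfl | rfl | hj <;>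
    rcases trich k with rfl | rfl | hk <;>
    simp only [GG_L, GG_P, GG_L', GG_P', ee_L, ee_P, ee_S, ss_L, ss_P, ss_S, pp_L, pp_P, pp_S,
      dd_S', *] <;>
    (try rw [e j i]) <;> (try rw [e k i]) <;> (try rw [e k j]) <;> field_simp <;> ring

/-- algebraic curvature shape -/
def KK {m : ℕ} (i j k h : Fin (m + 3)) : ℝ :=
  ee m i * ee m k * GG j h - ee m j * ee m k * GG i h
    - (ee m i * ee m h * GG j k - ee m j * ee m h * GG i k)

lemma R4_eq (hf : ContDiff ℝ (⊤ : ℕ∞) f) (hfpos : ∀ t, 0 < f t) (x : Fin (m + 3) → ℝ)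
    (i j k h : Fin (m + 3)) :
    R4E m f x i j k h = cE f (x (lastIdx m)) * f (x (lastIdx m)) * KK i j k h := by
  have hg : ∀ l, gE m f x l h = f (x (lastIdx m)) * ss m h * dd l h
      + pp m h * dd l (lastIdx m) + ee m h * dd l (penIdx m) := by
    intro l
    unfold gE
    have hL : ¬ ((lastIdx m : Fin (m+3)) : ℕ) < m + 1 := by simp [lastIdx]
    have hP : ¬ ((penIdx m : Fin (m+3)) : ℕ) < m + 1 := by simp [penIdx]
    have hLP : lastIdx m ≠ penIdx m := by simp [lastIdx, penIdx]
    simp only [ss, pp, ee, dd]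
    grind
  have hs : ∀ T : Fin (m+3) → ℝ, ∑ l, T l * gE m f x l h =
      f (x (lastIdx m)) * ss m h * T h + pp m h * T (lastIdx m) + ee m h * T (penIdx m) := by
    intro T
    have h' : ∀ l, T l * gE m f x l h = f (x (lastIdx m)) * ss m h * (if l = h then T l else 0)
        + pp m h * (if l = lastIdx m then T l else 0)
        + ee m h * (if l = penIdx m then T l else 0) := by
      intro l; rw [hg]; simp only [dd]; split_ifs <;> ring
    simp_rw [h', Finset.sum_add_distrib, ← Finset.mul_sum]
    simp only [Finset.sum_ite_eq', Finset.mem_univ, if_true]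
  unfold R4E KK
  rw [hs]
  simp only [Rop_eq hf hfpos, GG_L', GG_P', pp_L, pp_P]
  rcases trich h with rfl | rfl | hh <;>
    simp only [GG_L', GG_P', ee_L, ee_P, ee_S, ss_L, ss_P, ss_S, pp_L, pp_P, pp_S, *] <;> ring

lemma Ric_eq (hf : ContDiff ℝ (⊤ : ℕ∞) f) (hfpos : ∀ t, 0 < f t) (x : Fin (m + 3) → ℝ)
    (i j : Fin (m + 3)) :
    RicE m f x i j = cE f (x (lastIdx m)) * (((m : ℝ) + 1) * ee m i * ee m j) := by
  unfold RicE
  have h : ∀ k, RopE m f x i k j k = cE f (x (lastIdx m)) * ee m i * ee m j * ss m k := by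
    intro k
    rw [Rop_eq hf hfpos]
    have hk : GG k k = ss m k := by simp [GG, ss]
    rw [hk]
    rcases trich k with rfl | rfl | hh <;>
    simp only [GG_L, GG_L', GG_P, GG_P', ee_L, ee_P, ee_S, ss_L, ss_P, ss_S, pp_L, pp_P, pp_S, *] <;>
      ring
  simp_rw [h, ← Finset.mul_sum]
  have hsum : ∑ k, ss m k = (m : ℝ) + 1 := by
    have h3 : ∀ k : Fin (m + 1), ss m k.castSucc.castSucc = 1 := fun k => ss_S k.isLt
    have h4 : ss m (Fin.last (m + 1)).castSucc = 0 := by simp [ss]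
    have h5 : ss m (Fin.last (m + 2)) = 0 := by simp [ss]
    rw [Fin.sum_univ_castSucc, Fin.sum_univ_castSucc, h4, h5]
    simp [h3]
  rw [hsum]; ring

lemma c_diff (hf : ContDiff ℝ (⊤ : ℕ∞) f) (hfpos : ∀ t, 0 < f t) : Differentiable ℝ (cE f) := by
  have h0 := hf.differentiable (by simp)
  have h1 := (smooth1 hf).differentiable (by simp)
  have h2 := (smooth1 (smooth1 hf)).differentiable (by simp)
  intro t
  have := hfpos t
  unfold cE
  exact DifferentiableAt.div (((h1 t).pow 2).sub (((h0 t).const_mul 2).mul (h2 t)))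
    (((h0 t).pow 2).const_mul 4) (by positivity)

lemma covRic_eq (hf : ContDiff ℝ (⊤ : ℕ∞) f) (hfpos : ∀ t, 0 < f t) (x : Fin (m + 3) → ℝ)
    (a i j : Fin (m + 3)) :
    covRicE m f x a i j =
      deriv (cE f) (x (lastIdx m)) * ((m : ℝ) + 1) * ee m a * ee m i * ee m j := by
  unfold covRicE
  rw [Finset.sum_add_distrib, contract m f x (fun s => RicE m f x s j),
    contract m f x (fun s => RicE m f x i s)]
  simp only [Ric_eq hf hfpos]
  rw [pd_last m (fun t => cE f t * (((m : ℝ) + 1) * ee m i * ee m j)) _ x a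
    ((c_diff hf hfpos _).hasDerivAt.mul_const _)]
  have z : ∀ i, ss m i * ee m i = 0 := by
    intro i
    rcases trich i with rfl | rfl | hh <;> simp [ee_L, ee_P, ee_S, ss_L, ss_P, *]
  rw [ee_P]
  linear_combination (-cE f (x (lastIdx m)) * ((m : ℝ) + 1) * (deriv f (x (lastIdx m)) / (2 * f (x (lastIdx m)))) * 2 * ee m i * ee m j) * z a - (cE f (x (lastIdx m)) * ((m : ℝ) + 1) * (deriv f (x (lastIdx m)) / (2 * f (x (lastIdx m)))) * ee m a * ee m j) * z i - (cE f (x (lastIdx m)) * ((m : ℝ) + 1) * (deriv f (x (lastIdx m)) / (2 * f (x (lastIdx m)))) * ee m a * ee m i) * z j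

lemma KK_weight {m : ℕ} (i j k h : Fin (m + 3)) :
    (ss m i + ss m j + ss m k + ss m h) * KK i j k h = 2 * KK i j k h := by
  have z : ∀ i, ss m i * ee m i = 0 := by
    intro i
    rcases trich i with rfl | rfl | hh <;> simp [ee_L, ee_P, ee_S, ss_L, ss_P, *]
  have w : ∀ i j : Fin (m + 3), (ss m i + ss m j) * GG i j = 2 * GG i j := by
    intro i j
    by_cases e : i = j
    · subst e
      rcases trich i with rfl | rfl | hh
      · simp [GG_L]
      · simp [GG_P]
      · rw [ss_S hh]; ring
    · simp [GG, e]
  unfold KK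
  linear_combination (ee m k * GG j h - ee m h * GG j k) * z i
    + (ee m h * GG i k - ee m k * GG i h) * z j
    + (ee m i * GG j h - ee m j * GG i h) * z k
    + (ee m j * GG i k - ee m i * GG j k) * z h
    + ee m i * ee m k * w j h - ee m j * ee m k * w i h
    - ee m i * ee m h * w j k + ee m j * ee m h * w i k

lemma covR4_eq (hf : ContDiff ℝ (⊤ : ℕ∞) f) (hfpos : ∀ t, 0 < f t) (x : Fin (m + 3) → ℝ)
    (a i j k h : Fin (m + 3)) :
    covR4E m f x a i j k h =
      deriv (cE f) (x (lastIdx m)) * f (x (lastIdx m)) * ee m a * KK i j k h := by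
  have hne : f (x (lastIdx m)) ≠ 0 := (hfpos _).ne'
  unfold covR4E
  rw [Finset.sum_add_distrib, Finset.sum_add_distrib, Finset.sum_add_distrib,
    contract m f x (fun s => R4E m f x s j k h), contract m f x (fun s => R4E m f x i s k h),
    contract m f x (fun s => R4E m f x i j s h), contract m f x (fun s => R4E m f x i j k s)]
  simp only [R4_eq hf hfpos]
  rw [pd_last m (fun t => cE f t * f t * KK i j k h) _ x a
    (((c_diff hf hfpos _).hasDerivAt.mul (hd0 hf _)).mul_const _)]
  generalize deriv (cE f) (x (lastIdx m)) = c1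
  generalize cE f (x (lastIdx m)) = c
  generalize deriv f (x (lastIdx m)) = F1
  generalize f (x (lastIdx m)) = F at hne
  have e := @GG_comm m
  unfold KK
  rcases trich a with rfl | rfl | ha
  · have hK := KK_weight i j k h
    have hq : F1 / (2 * F) * F = F1 / 2 := by field_simp
    simp only [GG_L, ee_L, ss_L]
    unfold KK at hK
    linear_combination (-(c * F1 / 2)) * hK - c * (ss m i + ss m j + ss m k + ss m h) *
      (ee m i * ee m k * GG j h - ee m j * ee m k * GG i h
      - (ee m i * ee m h * GG j k - ee m j * ee m h * GG i k)) * hq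
  · simp only [GG_L, GG_P, GG_L', GG_P', ee_L, ee_P, ss_L, ss_P]
    ring
  · simp only [ee_S ha, ss_S ha, GG_P, GG_P', ee_P, e j a, e k a, e h a, e i a]
    ring
end

/-- an Egorov space has cyclic parallel Ricci tensor
(`(∇_X Ric)(X,X) = 0` for all `X`) if and only if it is locally symmetric, i.e. iff
`(f')² - 2ff'' = 4Cf²` for some constant `C`. -/
theorem egorov_cyclic_parallel_iff (m : ℕ) (f : ℝ → ℝ) (hf : ContDiff ℝ (⊤ : ℕ∞) f)
    (hfpos : ∀ t, 0 < f t) :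
    ((∀ (x : Fin (m + 3) → ℝ) (u : Fin (m + 3) → ℝ),
        (∑ a, ∑ i, ∑ j, u a * u i * u j * covRicE m f x a i j) = 0) ↔
      (∀ (x : Fin (m + 3) → ℝ) (a i j k h : Fin (m + 3)), covR4E m f x a i j k h = 0)) ∧
    ((∀ (x : Fin (m + 3) → ℝ) (u : Fin (m + 3) → ℝ),
        (∑ a, ∑ i, ∑ j, u a * u i * u j * covRicE m f x a i j) = 0) ↔
      (∃ C : ℝ, ∀ t : ℝ,
        (deriv f t) ^ 2 - 2 * f t * deriv (deriv f) t = 4 * C * (f t) ^ 2)) := by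
  have A : (∀ (x : Fin (m + 3) → ℝ) (u : Fin (m + 3) → ℝ),
        (∑ a, ∑ i, ∑ j, u a * u i * u j * covRicE m f x a i j) = 0) ↔
        ∀ t, deriv (cE f) t = 0 := by
    have key : ∀ (x : Fin (m + 3) → ℝ) (u : Fin (m + 3) → ℝ),
        (∑ a, ∑ i, ∑ j, u a * u i * u j * covRicE m f x a i j) =
          deriv (cE f) (x (lastIdx m)) * ((m : ℝ) + 1) * u (lastIdx m) ^ 3 := by
      intro x u
      simp only [covRic_eq hf hfpos, ee]
      simp
      ring
    constructor
    · intro H t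
      have h1 := H (fun _ => t) (fun _ => 1)
      rw [key] at h1
      have : (m : ℝ) + 1 ≠ 0 := by positivity
      simpa [this] using h1
    · intro H x u
      rw [key, H]; ring
  have B : (∀ (x : Fin (m + 3) → ℝ) (a i j k h : Fin (m + 3)), covR4E m f x a i j k h = 0) ↔
        ∀ t, deriv (cE f) t = 0 := by
    constructor
    · intro H t
      have h1 := H (fun _ => t) (lastIdx m) (lastIdx m) ⟨0, by omega⟩ (lastIdx m) ⟨0, by omega⟩
      rw [covR4_eq hf hfpos] at h1
      have h0 : ((⟨0, by omega⟩ : Fin (m + 3)) : ℕ) < m + 1 := by simp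
      have hG : GG (⟨0, by omega⟩ : Fin (m + 3)) ⟨0, by omega⟩ = 1 := by simp [GG]
      simp only [KK, ee_L, ee_S h0, hG, GG_L, GG_L'] at h1
      have := (hfpos t).ne'
      simpa [this] using h1
    · intro H x a i j k h
      rw [covR4_eq hf hfpos, H]; ring
  have C : (∃ C : ℝ, ∀ t : ℝ,
        (deriv f t) ^ 2 - 2 * f t * deriv (deriv f) t = 4 * C * (f t) ^ 2) ↔
        ∀ t, deriv (cE f) t = 0 := by
    constructor
    · rintro ⟨C, hC⟩ t
      have : cE f = fun _ => C := by
        funext s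
        have := (hfpos s).ne'
        rw [cE, hC]; field_simp
      simp [this]
    · intro H
      refine ⟨cE f 0, fun t => ?_⟩
      rw [is_const_of_deriv_eq_zero (c_diff hf hfpos) H 0 t, cE]
      have := (hfpos t).ne'
      field_simp
  exact ⟨A.trans B.symm, A.trans C.symm⟩
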